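/- In the algebra S, for all 1 ≤ j < i ≤ N and all r, s ≥ 0 one has (x_i^r y_i^r) y_j^s = q^{−sr} y_j^s (x_i^r y_i^r). -/

import Mathlib

open scoped BigOperators

noncomputable section

/-- The base field `F = ℚ(q)`, the field of rational functions in one variable over `ℚ`. -/
abbrev Fq : Type := RatFunc ℚ

/-- The element `q ∈ ℚ(q)`. -/
noncomputable def q : Fq := RatFunc.X

/-- Generators of the free algebra: `Sum.inl i` is `x_i` and `Sum.inr i` is `y_i`
(indices `0,…,N−1` corresponding to the indices `1,…,N` of the paper). -/
abbrev Gen (N : ℕ) := Fin N ⊕ Fin N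

/-- `x_i` in the free algebra. -/
noncomputable def FX (N : ℕ) (i : Fin N) : FreeAlgebra Fq (Gen N) :=
  FreeAlgebra.ι Fq (Sum.inl i)

/-- `y_i` in the free algebra. -/
noncomputable def FY (N : ℕ) (i : Fin N) : FreeAlgebra Fq (Gen N) :=
  FreeAlgebra.ι Fq (Sum.inr i)

/-- Scalars in the free algebra. -/
noncomputable def FC (N : ℕ) (a : Fq) : FreeAlgebra Fq (Gen N) :=
  algebraMap Fq _ a

/-- The defining relations of the algebra `S`:
`x_i x_j = q x_j x_i` for `i > j`; `y_i y_j = q y_j y_i` for `i < j`;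
`y_i x_j = x_j y_i` for `i ≠ j`; and
`y_i x_i = q x_i y_i + (q − q⁻¹) Σ_{r=1}^{i−1} (−q)^r x_{i−r} y_{i−r}`. -/
inductive SRel (N : ℕ) : FreeAlgebra Fq (Gen N) → FreeAlgebra Fq (Gen N) → Prop
  | xx (i j : Fin N) (h : j < i) :
      SRel N (FX N i * FX N j) (FC N q * (FX N j * FX N i))
  | yy (i j : Fin N) (h : i < j) :
      SRel N (FY N i * FY N j) (FC N q * (FY N j * FY N i))
  | yx (i j : Fin N) (h : i ≠ j) :
      SRel N (FY N i * FX N j) (FX N j * FY N i)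
  | yxi (i : Fin N) :
      SRel N (FY N i * FX N i)
        (FC N q * (FX N i * FY N i) +
          FC N (q - q⁻¹) *
            ∑ r ∈ Finset.Icc 1 (i : ℕ),
              FC N ((-q) ^ r) *
                (FX N ⟨(i : ℕ) - r, Nat.lt_of_le_of_lt (Nat.sub_le _ _) i.isLt⟩ *
                 FY N ⟨(i : ℕ) - r, Nat.lt_of_le_of_lt (Nat.sub_le _ _) i.isLt⟩))

/-- The algebra `S`: quotient of the free algebra by the defining relations. -/
abbrev SAlg (N : ℕ) := RingQuot (SRel N)

/-- `x_i ∈ S`. -/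
noncomputable def xel (N : ℕ) (i : Fin N) : SAlg N :=
  RingQuot.mkAlgHom Fq (SRel N) (FX N i)

/-- `y_i ∈ S`. -/
noncomputable def yel (N : ℕ) (i : Fin N) : SAlg N :=
  RingQuot.mkAlgHom Fq (SRel N) (FY N i)

/-- Scalars in `S`. -/
noncomputable def Cq (N : ℕ) (a : Fq) : SAlg N :=
  algebraMap Fq _ a

/-- `z_k = Σ_{r=0}^{k−1} (−q)^r x_{k−r} y_{k−r} ∈ S` (paper indexing `k = 0,1,…,N`,
with `z_0 = 0`); in the `0`-indexed generators this is
`Σ_{j < k} (−q)^{k−1−j} x_j y_j`. -/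
noncomputable def zel (N : ℕ) (k : ℕ) : SAlg N :=
  ∑ j : Fin N,
    if (j : ℕ) < k then Cq N ((-q) ^ (k - 1 - (j : ℕ))) * (xel N j * yel N j) else 0

/-- The balanced quantum integer `[k] = (q^k − q^{−k})/(q − q^{−1})`. -/
noncomputable def qint (k : ℕ) : Fq := (q ^ (k : ℤ) - q ^ (-(k : ℤ))) / (q - q⁻¹)

/-- The balanced quantum factorial `[k]!`. -/
noncomputable def qfact : ℕ → Fq
  | 0 => 1
  | k + 1 => qint (k + 1) * qfact k

/-- The balanced quantum binomial coefficient `[r choose s]`. -/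
noncomputable def qbinom (r s : ℕ) : Fq := qfact r / (qfact s * qfact (r - s))

end

/-- Elements that commute up to a scalar have powers that commute up to a power of it. -/
theorem pow_mul_pow_of_mul_eq_smul {R A : Type*} [CommSemiring R] [Semiring A] [Algebra R A]
    {a b : A} {c : R} (h : a * b = c • (b * a)) (r s : ℕ) :
    a ^ r * b ^ s = c ^ (s * r) • (b ^ s * a ^ r) := by
  have h₁ : ∀ r : ℕ, a ^ r * b = c ^ r • (b * a ^ r) := by
    intro r
    induction r with
    | zero => simp
    | succ r ih =>
      rw [pow_succ, mul_assoc, h, mul_smul_comm, ← mul_assoc, ih, smul_mul_assoc, smul_smul,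
        ← pow_succ', mul_assoc]
  induction s with
  | zero => simp
  | succ s ih =>
    rw [pow_succ, ← mul_assoc, ih, smul_mul_assoc, mul_assoc, h₁, mul_smul_comm, smul_smul,
      ← pow_add, ← mul_assoc, add_one_mul]

theorem commute_xel_yel {N : ℕ} {i j : Fin N} (h : j ≠ i) : Commute (xel N i) (yel N j) := by
  have := RingQuot.mkAlgHom_rel Fq (SRel.yx j i h)
  simpa [xel, yel, Commute, SemiconjBy] using this.symm

theorem yel_mul_yel {N : ℕ} {i j : Fin N} (h : j < i) :
    yel N i * yel N j = q⁻¹ • (yel N j * yel N i) := by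
  have hrel := RingQuot.mkAlgHom_rel Fq (SRel.yy j i h)
  have hq : q ≠ 0 := RatFunc.X_ne_zero
  rw [FC, ← Algebra.smul_def, map_smul, map_mul, map_mul] at hrel
  change yel N j * yel N i = q • (yel N i * yel N j) at hrel
  rw [hrel, inv_smul_smul₀ hq]

theorem stmt13 (N : ℕ) (hN : 2 ≤ N) (i j : Fin N) (hji : j < i) (r s : ℕ) :
    (xel N i ^ r * yel N i ^ r) * yel N j ^ s =
      Cq N (q ^ (-((s * r : ℕ) : ℤ))) * (yel N j ^ s * (xel N i ^ r * yel N i ^ r)) := by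
  rw [Cq, ← Algebra.smul_def, mul_assoc, pow_mul_pow_of_mul_eq_smul (yel_mul_yel hji),
    mul_smul_comm, ← mul_assoc, ((commute_xel_yel hji.ne).pow_pow r s).eq, mul_assoc,
    zpow_neg, zpow_natCast, inv_pow]
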